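/- arXiv:1612.09427 — 3 statements merged into one kernel-verified Lean document; each statement's English description precedes it below -/
import Mathlib

section
/- Let d ≥ 3, let F ≤ Sym({1,…,d}) be primitive but not cyclic of prime order, and set 𝔾 = U(F)⁺. Then 𝔾 acts transitively on the set of ends ∂𝒯 if and only if for every end ξ ∈ ∂𝒯 the stabilizer 𝔾_ξ = {g ∈ 𝔾 : g(ξ) = ξ} contains a hyperbolic element. -/
open Filter Topology
open scoped InnerProductSpace

namespace TreeHM

variable {V : Type}

/-! ### The automorphism group of a graph, with the topology of pointwise convergence -/

noncomputable instance autTopologicalSpace (T : SimpleGraph V) : TopologicalSpace (T ≃g T) :=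
  letI : TopologicalSpace V := ⊥
  TopologicalSpace.induced (fun (g : T ≃g T) (x : V) => g x) inferInstance

/-- A graph automorphism preserves the combinatorial distance. -/
theorem iso_dist_le (T : SimpleGraph V) (g : T ≃g T) (u v : V) :
    T.dist (g u) (g v) ≤ T.dist u v := by
  by_cases h : T.Reachable u v
  · obtain ⟨p, hp⟩ := h.exists_walk_length_eq_dist
    calc T.dist (g u) (g v) ≤ (p.map g.toHom).length := SimpleGraph.dist_le _
      _ = p.length := SimpleGraph.Walk.length_map _ _
      _ = T.dist u v := hp
  · rw [SimpleGraph.dist_eq_zero_of_not_reachable h,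
      SimpleGraph.dist_eq_zero_of_not_reachable]
    intro hr
    have := hr.map g.symm.toHom
    exact h (by simpa using this)

theorem iso_dist_eq (T : SimpleGraph V) (g : T ≃g T) (u v : V) :
    T.dist (g u) (g v) = T.dist u v := by
  refine le_antisymm (iso_dist_le T g u v) ?_
  have := iso_dist_le T g⁻¹ (g u) (g v)
  simpa using this

/-- The tree `T` is locally finite. -/
def LocFin (T : SimpleGraph V) : Prop := ∀ x : V, (T.neighborSet x).Finite

/-- The graph `T` is `d`-regular: every vertex has exactly `d` neighbours. -/
def Regular (T : SimpleGraph V) (d : ℕ) : Prop := ∀ x : V, (T.neighborSet x).ncard = d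

/-! ### Geodesic rays and ends -/

/-- A geodesic ray in a graph; for a tree, the ends `∂T` are the equivalence classes of
geodesic rays under the relation `RayEquiv` of sharing a common subray.  Throughout, an end
`ξ ∈ ∂T` is represented by a geodesic ray, and equality of ends is `RayEquiv`. -/
structure GeodRay (T : SimpleGraph V) : Type where
  seq : ℕ → V
  adj : ∀ n, T.Adj (seq n) (seq (n + 1))
  geodesic : ∀ m n, T.dist (seq m) (seq n) = Nat.dist m n

/-- A bi-infinite geodesic line in a graph. -/
structure GeodLine (T : SimpleGraph V) : Type where
  seq : ℤ → V
  adj : ∀ n, T.Adj (seq n) (seq (n + 1))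
  geodesic : ∀ m n, T.dist (seq m) (seq n) = (m - n).natAbs

/-- Two geodesic rays are equivalent (define the same end) iff they share a common subray. -/
def RayEquiv (T : SimpleGraph V) (r s : GeodRay T) : Prop :=
  ∃ k l : ℕ, ∀ n : ℕ, r.seq (k + n) = s.seq (l + n)

/-- The image of a geodesic ray under an automorphism. -/
def mapRay (T : SimpleGraph V) (g : T ≃g T) (r : GeodRay T) : GeodRay T where
  seq := fun n => g (r.seq n)
  adj := fun n => g.map_adj_iff.mpr (r.adj n)
  geodesic := fun m n => by rw [iso_dist_eq]; exact r.geodesic m n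

/-- `g` fixes the end represented by the ray `r`. -/
def FixesEnd (T : SimpleGraph V) (g : T ≃g T) (r : GeodRay T) : Prop :=
  RayEquiv T (mapRay T g r) r

/-- A sequence of vertices converges to the end represented by the geodesic ray `r`:
for every `m`, the vertex `r.seq m` eventually lies on the geodesic from `r.seq 0` to `y n`,
i.e. the common initial segment of `[r.seq 0, y n]` and the ray tends to infinity. -/
def TendstoEnd (T : SimpleGraph V) (y : ℕ → V) (r : GeodRay T) : Prop :=
  ∀ m : ℕ, ∀ᶠ n in atTop, T.dist (r.seq 0) (y n) = m + T.dist (r.seq m) (y n)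

/-! ### Translation length and hyperbolic automorphisms -/

/-- The translation length `|g| = min_x dist(x, g x)` of an automorphism. -/
noncomputable def transLen (T : SimpleGraph V) (g : T ≃g T) : ℕ :=
  sInf (Set.range fun x : V => T.dist x (g x))

/-- `g` is hyperbolic iff its translation length is positive. -/
def IsHyperbolic (T : SimpleGraph V) (g : T ≃g T) : Prop := 0 < transLen T g

/-- The set `Min(g)` of vertices realizing the translation length; for a hyperbolic
automorphism of a tree this is its translation axis. -/
def MinSet (T : SimpleGraph V) (g : T ≃g T) : Set V :=
  {x : V | T.dist x (g x) = transLen T g}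

/-- The ray `r` (based at the axis) represents the attracting end of `a`:
the orbit `a^n x` converges to this end. -/
def IsAttractingEnd (T : SimpleGraph V) (a : T ≃g T) (r : GeodRay T) : Prop :=
  TendstoEnd T (fun n : ℕ => (a ^ n) (r.seq 0)) r

/-! ### Half-trees and Tits' independence property -/

/-- The half-tree determined by an oriented edge `(a, b)` of a tree:  all vertices `y`
lying on the side of `a`, i.e. whose geodesic to `b` passes through `a`. -/
def EdgeSide (T : SimpleGraph V) (a b : V) : Set V :=
  {y : V | T.dist b y = T.dist a y + 1}

/-- The half-tree emanating from the base vertex `r.seq 0` of a ray `r` and containing the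
end of `r` in its boundary. -/
def RaySide (T : SimpleGraph V) (r : GeodRay T) : Set V :=
  {y : V | y = r.seq 0 ∨ T.dist (r.seq 0) y = 1 + T.dist (r.seq 1) y}

/-- Tits' independence property for a subgroup `G ≤ Aut(T)`:  for every edge `e = (a, b)`,
the pointwise stabilizer `G_e` decomposes as `G_{T₁} · G_{T₂}`, where `T₁, T₂` are the two
half-trees emanating from `e` and `G_{Tᵢ}` is the pointwise stabilizer of `Tᵢ`. -/
def TitsIndep (T : SimpleGraph V) (G : Subgroup (T ≃g T)) : Prop :=
  ∀ a b : V, T.Adj a b → ∀ g ∈ G, g a = a → g b = b →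
    ∃ g₁ ∈ G, ∃ g₂ ∈ G, g = g₁ * g₂ ∧
      (∀ y ∈ EdgeSide T a b, g₁ y = y) ∧ (∀ y ∈ EdgeSide T b a, g₂ y = y)

/-! ### Stabilizers and contraction groups -/

/-- The subgroup `G_ξ⁰ = {g ∈ G : g ξ = ξ and g fixes some vertex}`, as a subset of `G`. -/
def EndStab0 (T : SimpleGraph V) (G : Subgroup (T ≃g T)) (ξ : GeodRay T) : Set G :=
  {g : G | FixesEnd T (g : T ≃g T) ξ ∧ ∃ x : V, (g : T ≃g T) x = x}

/-- The contraction group `U⁺_α` of a sequence `α` in `G`. -/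
def ContrSeq {G : Type} [Group G] [TopologicalSpace G] (α : ℕ → G) : Set G :=
  {g : G | Tendsto (fun n : ℕ => (α n)⁻¹ * g * α n) atTop (𝓝 1)}

/-- The contraction group `U⁺_a = {g : a⁻ⁿ g aⁿ → 1}` of an element `a` of `G`. -/
def Upos {G : Type} [Group G] [TopologicalSpace G] (a : G) : Set G :=
  ContrSeq (fun n : ℕ => a ^ n)

/-- The contraction group `U⁻_a = {g : aⁿ g a⁻ⁿ → 1}` of an element `a` of `G`. -/
def Uneg {G : Type} [Group G] [TopologicalSpace G] (a : G) : Set G :=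
  ContrSeq (fun n : ℕ => (a ^ n)⁻¹)

/-! ### Unitary representations and the Howe–Moore property -/

/-- A (strongly continuous) unitary representation of a topological group `G` on a complex
inner product space `H`. -/
structure UnitaryRep (G : Type) [Group G] [TopologicalSpace G]
    (H : Type) [NormedAddCommGroup H] [InnerProductSpace ℂ H] where
  ρ : G →* (H ≃ₗᵢ[ℂ] H)
  strong_continuity : ∀ v : H, Continuous fun g : G => ρ g v

/-- The representation `π` has no nonzero `G`-invariant vector. -/
def NoInvariantVectors {G : Type} [Group G] [TopologicalSpace G]
    {H : Type} [NormedAddCommGroup H] [InnerProductSpace ℂ H]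
    (π : UnitaryRep G H) : Prop :=
  ∀ v : H, (∀ g : G, π.ρ g v = v) → v = 0

/-- The Howe–Moore property: every unitary representation without nonzero invariant vectors
has all its matrix coefficients vanishing at infinity. -/
def HasHoweMoore (G : Type) [Group G] [TopologicalSpace G] : Prop :=
  ∀ (H : Type) [NormedAddCommGroup H] [InnerProductSpace ℂ H] [CompleteSpace H]
    (π : UnitaryRep G H), NoInvariantVectors π →
      ∀ v w : H, Tendsto (fun g : G => ⟪π.ρ g v, w⟫_ℂ) (cocompact G) (𝓝 0)

/-! ### Legal colorings and the universal groups of Burger–Mozes -/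

/-- A legal coloring of a `d`-regular tree: a coloring of the (unoriented) edges by
`{1, …, d}` whose restriction to the star of each vertex is a bijection onto `{1, …, d}`.
The color of the edge `{x, y}` is recorded as `color x y` with `color x y = color y x`. -/
structure LegalColoring (T : SimpleGraph V) (d : ℕ) where
  color : V → V → Fin d
  symm : ∀ x y : V, T.Adj x y → color x y = color y x
  injOn : ∀ x : V, Set.InjOn (color x) (T.neighborSet x)
  surjOn : ∀ x : V, Set.SurjOn (color x) (T.neighborSet x) Set.univ

/-- Membership in the universal group `U(F)`: at every vertex `x` the local action of `g`
on colors is given by an element of `F`. -/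
def InUF {d : ℕ} (T : SimpleGraph V) (F : Subgroup (Equiv.Perm (Fin d)))
    (ι : LegalColoring T d) (g : T ≃g T) : Prop :=
  ∀ x : V, ∃ σ ∈ F, ∀ y : V, T.Adj x y → σ (ι.color x y) = ι.color (g x) (g y)

/-- The universal group `U(F)⁺`: the subgroup of `Aut(T)` generated by the elements of
`U(F)` fixing (pointwise) an edge of `T`. -/
def UFplus {d : ℕ} (T : SimpleGraph V) (F : Subgroup (Equiv.Perm (Fin d)))
    (ι : LegalColoring T d) : Subgroup (T ≃g T) :=
  Subgroup.closure
    {g : T ≃g T | InUF T F ι g ∧ ∃ x y : V, T.Adj x y ∧ g x = x ∧ g y = y}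

/-! ### Permutation group conditions -/

/-- `F` acts transitively on `{1, …, d}`. -/
def PermTransitive {d : ℕ} (F : Subgroup (Equiv.Perm (Fin d))) : Prop :=
  ∀ i j : Fin d, ∃ σ ∈ F, σ i = j

/-- `F` acts 2-transitively on `{1, …, d}`. -/
def PermTwoTransitive {d : ℕ} (F : Subgroup (Equiv.Perm (Fin d))) : Prop :=
  ∀ a b c e : Fin d, a ≠ b → c ≠ e → ∃ σ ∈ F, σ a = c ∧ σ b = e

/-- `F` acts primitively on `{1, …, d}`: it is transitive and every block of the action
is trivial (a subsingleton or the whole set). -/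
def PermPrimitive {d : ℕ} (F : Subgroup (Equiv.Perm (Fin d))) : Prop :=
  PermTransitive F ∧
    ∀ B : Set (Fin d),
      (∀ σ ∈ F, (σ : Equiv.Perm (Fin d)) '' B = B ∨
        Disjoint ((σ : Equiv.Perm (Fin d)) '' B) B) →
      B.Subsingleton ∨ B = Set.univ

/-- `F` is a cyclic group of prime order. -/
def CyclicOfPrimeOrder {d : ℕ} (F : Subgroup (Equiv.Perm (Fin d))) : Prop :=
  IsCyclic F ∧ (Nat.card F).Prime

/-- `F` is generated by its point stabilizers `F_i = {σ ∈ F : σ i = i}`. -/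
def GenByPointStabilizers {d : ℕ} (F : Subgroup (Equiv.Perm (Fin d))) : Prop :=
  F = Subgroup.closure {σ : Equiv.Perm (Fin d) | σ ∈ F ∧ ∃ i : Fin d, σ i = i}


section Helpers

variable {T : SimpleGraph V}

theorem par_unique (hT : T.IsTree) {a v p q : V} (hp : T.Adj v p) (hq : T.Adj v q)
    (dp : T.dist a v = T.dist a p + 1) (dq : T.dist a v = T.dist a q + 1) : p = q := by
  obtain ⟨P, hP⟩ := (hT.connected a p).exists_walk_length_eq_dist
  obtain ⟨Q, hQ⟩ := (hT.connected a q).exists_walk_length_eq_dist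
  have h1 : (P.concat hp.symm).IsPath := by
    apply SimpleGraph.Walk.isPath_of_length_eq_dist
    rw [SimpleGraph.Walk.length_concat]; omega
  have h2 : (Q.concat hq.symm).IsPath := by
    apply SimpleGraph.Walk.isPath_of_length_eq_dist
    rw [SimpleGraph.Walk.length_concat]; omega
  have h3 := (hT.existsUnique_path a v).unique h1 h2
  have h4 := congrArg SimpleGraph.Walk.penultimate h3
  simpa using h4

theorem par_exists (hT : T.IsTree) (a v : V) (h : v ≠ a) :
    ∃ p, T.Adj v p ∧ T.dist a v = T.dist a p + 1 := by
  obtain ⟨P, hP⟩ := (hT.connected v a).exists_walk_length_eq_dist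
  cases P with
  | nil => exact absurd rfl h
  | @cons _ p _ hadj P =>
    refine ⟨p, hadj, ?_⟩
    rw [SimpleGraph.Walk.length_cons] at hP
    have h1 := SimpleGraph.dist_le P
    have h2 := hT.dist_eq_dist_add_one_of_adj a hadj
    rw [SimpleGraph.dist_comm (u := v)] at hP
    rw [SimpleGraph.dist_comm (u := p)] at h1
    omega

open Classical in
noncomputable def par (T : SimpleGraph V) (a v : V) : V :=
  if h : ∃ p, T.Adj v p ∧ T.dist a v = T.dist a p + 1 then h.choose else v

theorem par_spec (hT : T.IsTree) {a v : V} (h : v ≠ a) :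
    T.Adj v (par T a v) ∧ T.dist a v = T.dist a (par T a v) + 1 := by
  have := par_exists hT a v h
  unfold par
  rw [dif_pos this]
  exact this.choose_spec

theorem par_eq (hT : T.IsTree) {a v p : V} (hp : T.Adj v p)
    (dp : T.dist a v = T.dist a p + 1) : par T a v = p := by
  have h : v ≠ a := by
    rintro rfl
    rw [SimpleGraph.dist_self] at dp; omega
  exact par_unique hT (par_spec hT h).1 hp (par_spec hT h).2 dp

/-- for adjacent vertices one is the parent of the other -/
theorem adj_par (hT : T.IsTree) (a : V) {v w : V} (h : T.Adj v w) :
    (w ≠ a ∧ par T a w = v ∧ T.dist a w = T.dist a v + 1) ∨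
    (v ≠ a ∧ par T a v = w ∧ T.dist a v = T.dist a w + 1) := by
  rcases hT.dist_eq_dist_add_one_of_adj a h with h1 | h1
  · right
    refine ⟨?_, par_eq hT h h1, h1⟩
    rintro rfl
    rw [SimpleGraph.dist_self] at h1; omega
  · left
    refine ⟨?_, par_eq hT h.symm h1, h1⟩
    rintro rfl
    rw [SimpleGraph.dist_self] at h1; omega

theorem rec_exists (hT : T.IsTree) (a : V) {X : Type} (x0 : X) (step : V → X → X) :
    ∃ f : V → X, f a = x0 ∧ ∀ v, v ≠ a → f v = step v (f (par T a v)) := by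
  let S : ℕ → V → X := fun n => Nat.rec (fun _ => x0) (fun _ ih v => step v (ih (par T a v))) n
  refine ⟨fun v => S (T.dist a v) v, ?_, ?_⟩
  · simp [S]
  · intro v hv
    show S (T.dist a v) v = step v (S (T.dist a (par T a v)) (par T a v))
    rw [(par_spec hT hv).2]

theorem tree_ind (hT : T.IsTree) (a : V) {P : V → Prop} (h0 : P a)
    (h1 : ∀ v, v ≠ a → P (par T a v) → P v) : ∀ v, P v := by
  have : ∀ n v, T.dist a v = n → P v := by
    intro n
    induction n with
    | zero =>
      intro v hv
      have := (hT.connected.dist_eq_zero_iff).1 hv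
      rwa [← this]
    | succ n ih =>
      intro v hv
      have hva : v ≠ a := by
        rintro rfl
        rw [SimpleGraph.dist_self] at hv; omega
      refine h1 v hva (ih _ ?_)
      have := (par_spec hT hva).2
      omega
  exact fun v => this _ v rfl

/-! non-backtracking sequences -/

theorem nb_dist (hT : T.IsTree) (x : ℕ → V) (hadj : ∀ n, T.Adj (x n) (x (n + 1)))
    (hnb : ∀ n, x n ≠ x (n + 2)) (n : ℕ) :
    T.dist (x 0) (x n) = n ∧ T.dist (x 0) (x (n + 1)) = n + 1 := by
  induction n with
  | zero =>
    refine ⟨SimpleGraph.dist_self, ?_⟩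
    simpa using SimpleGraph.dist_eq_one_iff_adj.2 (hadj 0)
  | succ n ih =>
    refine ⟨ih.2, ?_⟩
    rcases hT.dist_eq_dist_add_one_of_adj (x 0) (hadj (n + 1)) with h | h
    · exfalso
      apply hnb n
      refine par_unique hT (a := x 0) (hadj n).symm (hadj (n + 1)) ?_ h
      omega
    · rw [h]; omega

def mkRay (hT : T.IsTree) (x : ℕ → V) (hadj : ∀ n, T.Adj (x n) (x (n + 1)))
    (hnb : ∀ n, x n ≠ x (n + 2)) : GeodRay T where
  seq := x
  adj := hadj
  geodesic := by
    have key : ∀ m n, m ≤ n → T.dist (x m) (x n) = Nat.dist m n := by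
      intro m n h
      obtain ⟨k, rfl⟩ := Nat.exists_eq_add_of_le h
      have := (nb_dist hT (fun i => x (m + i)) (fun i => hadj (m + i))
        (fun i => hnb (m + i)) k).1
      simp only [add_zero] at this
      rw [this, Nat.dist]; omega
    intro m n
    rcases le_total m n with h | h
    · exact key m n h
    · rw [SimpleGraph.dist_comm, key n m h, Nat.dist_comm]

theorem ray_nb (r : GeodRay T) (n : ℕ) : r.seq n ≠ r.seq (n + 2) := by
  intro h
  have := r.geodesic n (n + 2)
  rw [h, SimpleGraph.dist_self, Nat.dist] at this
  omega

theorem ray_dist (r : GeodRay T) (n : ℕ) : T.dist (r.seq 0) (r.seq n) = n := by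
  rw [r.geodesic, Nat.dist]; omega

theorem ray_inj (r : GeodRay T) {m n : ℕ} (h : r.seq m = r.seq n) : m = n := by
  have := r.geodesic m n
  rw [h, SimpleGraph.dist_self, Nat.dist] at this
  omega

theorem RayEquiv.refl' (r : GeodRay T) : RayEquiv T r r := ⟨0, 0, fun _ => rfl⟩

theorem RayEquiv.symm' {r s : GeodRay T} (h : RayEquiv T r s) : RayEquiv T s r := by
  obtain ⟨k, l, h⟩ := h
  exact ⟨l, k, fun n => (h n).symm⟩

theorem RayEquiv.trans' {r s t : GeodRay T} (h : RayEquiv T r s) (h' : RayEquiv T s t) :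
    RayEquiv T r t := by
  obtain ⟨k, l, h⟩ := h
  obtain ⟨k', l', h'⟩ := h'
  refine ⟨k + k', l' + l, fun n => ?_⟩
  rw [add_assoc, h, ← add_assoc, add_comm l k', add_assoc, h', add_assoc]

theorem RayEquiv.map' (g : T ≃g T) {r s : GeodRay T} (h : RayEquiv T r s) :
    RayEquiv T (mapRay T g r) (mapRay T g s) := by
  obtain ⟨k, l, h⟩ := h
  exact ⟨k, l, fun n => congrArg g (h n)⟩

def shiftRay (r : GeodRay T) (k : ℕ) : GeodRay T where
  seq := fun n => r.seq (k + n)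
  adj := fun n => r.adj (k + n)
  geodesic := fun m n => by
    rw [r.geodesic]; simp only [Nat.dist]; omega

def consRay (hT : T.IsTree) (r : GeodRay T) (v : V) (h : T.Adj v (r.seq 0))
    (h1 : v ≠ r.seq 1) : GeodRay T :=
  mkRay hT (fun n => Nat.casesOn n v r.seq)
    (fun n => by cases n with | zero => exact h | succ n => exact r.adj n)
    (fun n => by cases n with | zero => exact h1 | succ n => exact ray_nb r n)

theorem exists_ray_from (hT : T.IsTree) (r : GeodRay T) (v : V) :
    ∃ s : GeodRay T, s.seq 0 = v ∧ RayEquiv T s r := by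
  refine tree_ind hT (r.seq 0) (P := fun v => ∃ s : GeodRay T, s.seq 0 = v ∧ RayEquiv T s r)
    ⟨r, rfl, RayEquiv.refl' r⟩ ?_ v
  rintro v hv ⟨s, hs, hsr⟩
  by_cases h : v = s.seq 1
  · refine ⟨shiftRay s 1, h.symm, RayEquiv.trans' ⟨0, 1, fun n => ?_⟩ hsr⟩
    simp [shiftRay]
  · refine ⟨consRay hT s v ?_ h, rfl, RayEquiv.trans' ⟨1, 0, fun n => ?_⟩ hsr⟩
    · rw [hs]; exact (par_spec hT hv).1
    · rw [add_comm 1 n, zero_add]; rfl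

/-! colours -/

variable {d : ℕ} (ι : LegalColoring T d)

noncomputable def nbr (v : V) (c : Fin d) : V := (ι.surjOn v (Set.mem_univ c)).choose

theorem nbr_adj (v : V) (c : Fin d) : T.Adj v (nbr ι v c) :=
  (ι.surjOn v (Set.mem_univ c)).choose_spec.1

theorem color_nbr (v : V) (c : Fin d) : ι.color v (nbr ι v c) = c :=
  (ι.surjOn v (Set.mem_univ c)).choose_spec.2

theorem nbr_eq {v w : V} {c : Fin d} (h : T.Adj v w) (hc : ι.color v w = c) :
    nbr ι v c = w :=
  ι.injOn v (nbr_adj ι v c) h (by rw [color_nbr, hc])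

theorem color_ne {v w w' : V} (h : T.Adj v w) (h' : T.Adj v w') (hne : w ≠ w') :
    ι.color v w ≠ ι.color v w' := fun hc => hne (ι.injOn v h h' hc)

/-- Existence of an automorphism with prescribed local actions. -/
theorem exists_aut (hT : T.IsTree) (a : V) (σ : V → Equiv.Perm (Fin d))
    (hσ : ∀ v w, T.Adj v w → σ v (ι.color v w) = σ w (ι.color v w)) :
    ∃ g : T ≃g T, g a = a ∧
      ∀ v w, T.Adj v w → σ v (ι.color v w) = ι.color (g v) (g w) := by
  obtain ⟨g, ga, gs⟩ := rec_exists hT a a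
    (fun v x => nbr ι x (σ (par T a v) (ι.color (par T a v) v)))
  have hg : ∀ v w, T.Adj v w → g w = nbr ι (g v) (σ v (ι.color v w)) := by
    intro v w h
    rcases adj_par hT a h with ⟨h1, h2, -⟩ | ⟨h1, h2, -⟩
    · have := gs w h1
      rw [h2] at this; exact this
    · have h3 := gs v h1
      rw [h2] at h3
      symm
      have hadj : T.Adj (g w) (g v) := by rw [h3]; exact nbr_adj _ _ _
      refine nbr_eq ι hadj.symm ?_
      rw [ι.symm _ _ hadj.symm]
      conv_lhs => rw [h3]
      rw [color_nbr, hσ v w h, ι.symm v w h]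
  have hadj : ∀ v w, T.Adj v w → T.Adj (g v) (g w) := by
    intro v w h; rw [hg v w h]; exact nbr_adj _ _ _
  have hcol : ∀ v w, T.Adj v w → σ v (ι.color v w) = ι.color (g v) (g w) := by
    intro v w h; rw [hg v w h, color_nbr]
  have hsurjn : ∀ v y, T.Adj (g v) y → ∃ w, T.Adj v w ∧ g w = y := by
    intro v y h
    refine ⟨nbr ι v ((σ v)⁻¹ (ι.color (g v) y)), nbr_adj _ _ _, ?_⟩
    rw [hg v _ (nbr_adj _ _ _), color_nbr]
    exact nbr_eq ι h (by simp)
  have hinjn : ∀ v w w', T.Adj v w → T.Adj v w' → g w = g w' → w = w' := by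
    intro v w w' h h' e
    refine ι.injOn v h h' ((σ v).injective ?_)
    rw [hcol v w h, hcol v w' h', e]
  have hd : ∀ v, T.dist a (g v) = T.dist a v ∧
      (v ≠ a → T.dist a (g v) = T.dist a (g (par T a v)) + 1) := by
    refine tree_ind hT a ⟨by rw [ga], fun h => absurd rfl h⟩ ?_
    intro v hv ih
    set p := par T a v with hp
    have hvp := par_spec hT hv
    rw [← hp] at hvp
    have key : T.dist a (g v) = T.dist a (g p) + 1 := by
      rcases hT.dist_eq_dist_add_one_of_adj a (hadj v p hvp.1) with h | h
      · exact h
      · exfalso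
        by_cases hpa : p = a
        · rw [hpa, ga, SimpleGraph.dist_self] at h; omega
        · have h2 := ih.2 hpa
          have h3 := par_spec hT hpa
          have h4 := par_unique hT (hadj p v hvp.1.symm) (hadj p _ h3.1) h h2
          have h5 := hinjn p _ _ hvp.1.symm h3.1 h4
          have := h3.2
          have := hvp.2
          rw [← h5] at *
          omega
    refine ⟨?_, fun _ => key⟩
    rw [key, ih.1, hvp.2]
  have hinj : Function.Injective g := by
    suffices H : ∀ v w, g v = g w → v = w from fun v w => H v w
    refine tree_ind hT a ?_ ?_
    · intro w h
      have := (hd w).1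
      rw [← h, ga, SimpleGraph.dist_self] at this
      exact (hT.connected.dist_eq_zero_iff).1 this.symm
    · intro v hv ih w h
      have hw : w ≠ a := by
        rintro rfl
        have := (hd v).1
        rw [h, ga, SimpleGraph.dist_self] at this
        exact hv ((hT.connected.dist_eq_zero_iff).1 this.symm).symm
      have h1 := (hd v).2 hv
      have h2 := (hd w).2 hw
      have h3 := par_spec hT hv
      have h4 := par_spec hT hw
      have h5 := hadj _ _ h3.1
      have h6 := hadj _ _ h4.1
      rw [← h] at h2 h6
      have h7 := par_unique hT h5 h6 h1 h2
      have h8 := ih _ h7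
      refine hinjn (par T a v) v w h3.1.symm ?_ h
      rw [h8]; exact h4.1.symm
  have hsurj : Function.Surjective g := by
    refine tree_ind hT a ⟨a, ga⟩ ?_
    rintro y hy ⟨v, hv⟩
    have := (par_spec hT hy).1.symm
    rw [← hv] at this
    obtain ⟨w, -, hw⟩ := hsurjn v y this
    exact ⟨w, hw⟩
  refine ⟨⟨Equiv.ofBijective g ⟨hinj, hsurj⟩, ?_⟩, ga, hcol⟩
  intro v w
  refine ⟨fun h => ?_, fun h => hadj v w h⟩
  obtain ⟨w', h1, h2⟩ := hsurjn v (g w) h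
  rwa [← hinj h2]

variable (F : Subgroup (Equiv.Perm (Fin d)))

theorem key_lemma (hT : T.IsTree) (h2 : PermTwoTransitive F) (r s : GeodRay T) (b : V)
    (hrs : r.seq 0 = s.seq 0) (hb : T.Adj (r.seq 0) b) (hbr : b ≠ r.seq 1)
    (hbs : b ≠ s.seq 1) :
    ∃ g ∈ UFplus T F ι, ∀ n, g (r.seq n) = s.seq n := by
  classical
  have hτ : ∀ n, ∃ τ ∈ F, τ (ι.color (r.seq n) (r.seq (n + 1))) =
        ι.color (s.seq n) (s.seq (n + 1)) ∧
      (n = 0 → τ (ι.color (r.seq 0) b) = ι.color (r.seq 0) b) ∧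
      (∀ m, n = m + 1 → τ (ι.color (r.seq m) (r.seq (m + 1))) =
        ι.color (s.seq m) (s.seq (m + 1))) := by
    intro n
    cases n with
    | zero =>
      obtain ⟨τ, hτ, h3, h4⟩ := h2 (ι.color (r.seq 0) (r.seq 1)) (ι.color (r.seq 0) b)
        (ι.color (s.seq 0) (s.seq 1)) (ι.color (r.seq 0) b)
        (color_ne ι (r.adj 0) hb hbr.symm)
        (by rw [hrs]; exact color_ne ι (s.adj 0) (hrs ▸ hb) hbs.symm)
      exact ⟨τ, hτ, h3, fun _ => h4, fun m hm => by omega⟩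
    | succ m =>
      obtain ⟨τ, hτ, h3, h4⟩ := h2 (ι.color (r.seq (m + 1)) (r.seq (m + 1 + 1)))
        (ι.color (r.seq m) (r.seq (m + 1)))
        (ι.color (s.seq (m + 1)) (s.seq (m + 1 + 1)))
        (ι.color (s.seq m) (s.seq (m + 1)))
        (by rw [ι.symm _ _ (r.adj m)]
            exact color_ne ι (r.adj _) (r.adj m).symm (ray_nb r m).symm)
        (by rw [ι.symm _ _ (s.adj m)]
            exact color_ne ι (s.adj _) (s.adj m).symm (ray_nb s m).symm)
      refine ⟨τ, hτ, h3, fun h => by omega, fun m' hm => ?_⟩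
      obtain rfl : m = m' := by omega
      exact h4
  choose τ hτF hτ1 hτ0 hτs using hτ
  have hpar : ∀ n, par T (r.seq 0) (r.seq (n + 1)) = r.seq n := fun n =>
    par_eq hT (r.adj n).symm (by rw [ray_dist, ray_dist])
  have hr0 : ∀ n, r.seq (n + 1) ≠ r.seq 0 := fun n h => by
    have := ray_inj r h; omega
  obtain ⟨N, N0, Ns⟩ := rec_exists hT (r.seq 0) (0 : ℕ)
    (fun v n => if v = r.seq (n + 1) then n + 1 else n)
  have Nr : ∀ n, N (r.seq n) = n := by
    intro n
    induction n with
    | zero => exact N0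
    | succ n ih => rw [Ns _ (hr0 n), hpar, ih, if_pos rfl]
  -- compatibility along parents
  have hcomp : ∀ w, w ≠ r.seq 0 → ∀ p, p = par T (r.seq 0) w →
      τ (N w) (ι.color p w) = τ (N p) (ι.color p w) := by
    intro w hw p hp
    have h3 := Ns w hw
    rw [← hp] at h3
    split_ifs at h3 with h4
    · have h5 : p = r.seq (N p) := by rw [hp, h4, hpar, Nr]
      generalize N p = n at *
      rw [h3, h4, h5, hτ1, hτs (n + 1) n rfl]
    · rw [h3]
  obtain ⟨g, ga, hg⟩ := exists_aut ι hT (r.seq 0) (fun v => τ (N v)) (by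
    intro v w h
    rcases adj_par hT (r.seq 0) h with ⟨h3, h4, -⟩ | ⟨h3, h4, -⟩
    · exact (hcomp w h3 v h4.symm).symm
    · rw [ι.symm v w h]
      exact hcomp v h3 w h4.symm)
  refine ⟨g, Subgroup.subset_closure ⟨?_, r.seq 0, b, hb, ga, ?_⟩, ?_⟩
  · intro x
    exact ⟨τ (N x), hτF _, fun y hy => hg x y hy⟩
  · have h3 := hg _ _ hb
    simp only [N0, hτ0 0 rfl] at h3
    rw [ga] at h3
    have h4 := g.map_adj_iff.2 hb
    rw [ga] at h4
    exact ι.injOn _ h4 hb h3.symm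
  · intro n
    induction n with
    | zero => rw [ga, hrs]
    | succ n ih =>
      have h3 := hg _ _ (r.adj n)
      have h4 := g.map_adj_iff.2 (r.adj n)
      simp only [Nr, hτ1] at h3
      rw [ih] at h3 h4
      exact ι.injOn _ h4 (s.adj n) h3.symm

theorem exists_third {T : SimpleGraph V} {d : ℕ} (ι : LegalColoring T d) (hd : 3 ≤ d) (v x y : V) : ∃ b, T.Adj v b ∧ b ≠ x ∧ b ≠ y := by
  have : ∃ c : Fin d, c ∉ ({ι.color v x, ι.color v y} : Finset (Fin d)) := by
    by_contra h
    push Not at h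
    have h1 : (Finset.univ : Finset (Fin d)) ⊆ {ι.color v x, ι.color v y} := fun c _ => h c
    have h2 := Finset.card_le_card h1
    have h3 := Finset.card_le_two (a := ι.color v x) (b := ι.color v y)
    rw [Finset.card_univ, Fintype.card_fin] at h2
    omega
  obtain ⟨c, hc⟩ := this
  simp only [Finset.mem_insert, Finset.mem_singleton, not_or] at hc
  refine ⟨nbr ι v c, nbr_adj _ _ _, ?_, ?_⟩
  · rintro rfl; exact hc.1 (color_nbr ι v c).symm
  · rintro rfl; exact hc.2 (color_nbr ι v c).symm

theorem trans_of_two (hd : 3 ≤ d) (hT : T.IsTree) (h2 : PermTwoTransitive F)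
    (ξ η : GeodRay T) : ∃ g ∈ UFplus T F ι, RayEquiv T (mapRay T g ξ) η := by
  obtain ⟨s, hs, hsη⟩ := exists_ray_from hT η (ξ.seq 0)
  obtain ⟨b, hb, h3, h4⟩ := exists_third ι hd (ξ.seq 0) (ξ.seq 1) (s.seq 1)
  obtain ⟨g, hg, h⟩ := key_lemma ι F hT h2 ξ s b hs.symm hb h3 h4
  exact ⟨g, hg, RayEquiv.trans' ⟨0, 0, fun n => h _⟩ hsη⟩

/-- rays from colour sequences -/
theorem exists_color_ray (hT : T.IsTree) (a : V) (c : ℕ → Fin d)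
    (hc : ∀ n, c n ≠ c (n + 1)) :
    ∃ r : GeodRay T, r.seq 0 = a ∧ ∀ n, ι.color (r.seq n) (r.seq (n + 1)) = c n := by
  let x : ℕ → V := fun n => Nat.rec a (fun n v => nbr ι v (c n)) n
  have hx : ∀ n, x (n + 1) = nbr ι (x n) (c n) := fun n => rfl
  have hadj : ∀ n, T.Adj (x n) (x (n + 1)) := fun n => by rw [hx]; exact nbr_adj _ _ _
  have hcol : ∀ n, ι.color (x n) (x (n + 1)) = c n := fun n => by rw [hx, color_nbr]
  refine ⟨mkRay hT x hadj ?_, rfl, hcol⟩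
  intro n h
  apply hc n
  rw [← hcol n, ← hcol (n + 1), ι.symm _ _ (hadj n)]
  rw [show n + 1 + 1 = n + 2 from rfl, ← h]

theorem hyp_of_two (hd : 3 ≤ d) (hT : T.IsTree) (h2 : PermTwoTransitive F)
    (ξ : GeodRay T) : ∃ g ∈ UFplus T F ι, FixesEnd T g ξ ∧ IsHyperbolic T g := by
  -- a neighbour s1 of ξ 1 other than ξ 2, and a ray through it
  obtain ⟨s, hs0, hs1⟩ : ∃ s : GeodRay T, s.seq 0 = ξ.seq 1 ∧ s.seq 1 ≠ ξ.seq 2 := by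
    obtain ⟨b, hb, hb1, hb2⟩ := exists_third ι hd (ξ.seq 1) (ξ.seq 2) (ξ.seq 2)
    obtain ⟨e, he, he1, -⟩ := exists_third ι hd b (ξ.seq 1) (ξ.seq 1)
    have hne : ι.color (ξ.seq 1) b ≠ ι.color b e := by
      rw [ι.symm _ _ hb]
      exact color_ne ι hb.symm he he1.symm
    obtain ⟨s, hs, hcol⟩ := exists_color_ray ι hT (ξ.seq 1)
      (fun n => if n % 2 = 0 then ι.color (ξ.seq 1) b else ι.color b e) (by
        intro n
        rcases Nat.mod_two_eq_zero_or_one n with h | h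
        · have : (n + 1) % 2 = 1 := by omega
          simp only [h, this]; simpa using hne
        · have : (n + 1) % 2 = 0 := by omega
          simp only [h, this]; simpa using hne.symm)
    refine ⟨s, hs, ?_⟩
    have h3 := hcol 0
    have h4 := s.adj 0
    simp only [Nat.zero_mod, if_true, zero_add] at h3 h4
    rw [hs] at h3 h4
    rw [ι.injOn _ h4 hb h3]
    exact hb1
  obtain ⟨z, hz, hz1, hz2⟩ := exists_third ι hd (ξ.seq 1) (ξ.seq 2) (s.seq 1)
  obtain ⟨g, hg, hgr⟩ := key_lemma ι F hT h2 (shiftRay ξ 1) s z hs0.symm hz hz1 hz2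
  have hadj : T.Adj (ξ.seq 2) (s.seq 0) := by rw [hs0]; exact (ξ.adj 1).symm
  let t := consRay hT s (ξ.seq 2) hadj hs1.symm
  obtain ⟨u, hu, hu1, hu2⟩ := exists_third ι hd (ξ.seq 2) (s.seq 0) (ξ.seq 3)
  obtain ⟨h, hh, hhr⟩ := key_lemma ι F hT h2 t (shiftRay ξ 2) u rfl hu hu1 hu2
  have hgh : ∀ n, (h * g) (ξ.seq (1 + n)) = ξ.seq (3 + n) := by
    intro n
    have h3 : g (ξ.seq (1 + n)) = s.seq n := hgr n
    have h4 : h (s.seq n) = ξ.seq (2 + (n + 1)) := hhr (n + 1)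
    show h (g _) = _
    rw [h3, h4]; congr 1; omega
  refine ⟨h * g, mul_mem hh hg, ⟨1, 3, hgh⟩, ?_⟩
  unfold IsHyperbolic transLen
  rw [Nat.pos_iff_ne_zero]
  intro h0
  rw [Nat.sInf_eq_zero] at h0
  rcases h0 with ⟨x, hx⟩ | h0
  · have hx : x = (h * g) x := (hT.connected.dist_eq_zero_iff).1 hx
    obtain ⟨y, hy, k, l, hkl⟩ := exists_ray_from hT ξ x
    have hdist : ∀ n, T.dist x (ξ.seq (l + n)) = k + n := by
      intro n; rw [← hkl, ← hy, ray_dist]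
    have h5 : T.dist x (ξ.seq (1 + l)) = T.dist x (ξ.seq (3 + l)) := by
      rw [← hgh, ← iso_dist_eq T (h * g) x, ← hx]
    rw [add_comm 1, add_comm 3, hdist, hdist] at h5
    omega
  · have : Nonempty V := ⟨ξ.seq 0⟩
    exact absurd h0 (Set.range_nonempty _).ne_empty

theorem inUF_of_mem {g : T ≃g T} (hg : g ∈ UFplus T F ι) : InUF T F ι g := by
  induction hg using Subgroup.closure_induction with
  | mem x hx => exact hx.1
  | one => exact fun x => ⟨1, one_mem _, fun y _ => rfl⟩
  | mul g h _ _ ihg ihh =>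
    intro x
    obtain ⟨σ, hσ, h1⟩ := ihh x
    obtain ⟨τ, hτ, h2⟩ := ihg (h x)
    refine ⟨τ * σ, mul_mem hτ hσ, fun y hy => ?_⟩
    rw [Equiv.Perm.mul_apply, h1 y hy, h2 _ (h.map_adj_iff.2 hy)]
    rfl
  | inv g _ ih =>
    intro x
    obtain ⟨σ, hσ, h1⟩ := ih (g⁻¹ x)
    refine ⟨σ⁻¹, inv_mem hσ, fun y hy => ?_⟩
    have h2 := h1 (g⁻¹ y) ((g⁻¹).map_adj_iff.2 hy)
    have e : ∀ z, g (g⁻¹ z) = z := fun z => by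
      show (g * g⁻¹) z = z
      rw [mul_inv_cancel]; rfl
    rw [e, e] at h2
    rw [← h2]; simp

def typ (i j c e : Fin d) : Prop := ∃ σ ∈ F, σ i = c ∧ σ j = e

theorem typ_iff {σ : Equiv.Perm (Fin d)} (hσ : σ ∈ F) (i j c e : Fin d) :
    typ F i j (σ c) (σ e) ↔ typ F i j c e := by
  constructor
  · rintro ⟨τ, hτ, h1, h2⟩
    exact ⟨σ⁻¹ * τ, mul_mem (inv_mem hσ) hτ, by simp [h1], by simp [h2]⟩
  · rintro ⟨τ, hτ, h1, h2⟩
    exact ⟨σ * τ, mul_mem hσ hτ, by simp [h1], by simp [h2]⟩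

theorem typ_ray {g : T ≃g T} (hg : g ∈ UFplus T F ι) (i j : Fin d) (r s : GeodRay T) (k l : ℕ)
    (h : ∀ n, g (r.seq (k + n)) = s.seq (l + n)) (n : ℕ) :
    typ F i j (ι.color (s.seq (l + n)) (s.seq (l + n + 1)))
        (ι.color (s.seq (l + n + 1)) (s.seq (l + n + 2))) ↔
    typ F i j (ι.color (r.seq (k + n)) (r.seq (k + n + 1)))
        (ι.color (r.seq (k + n + 1)) (r.seq (k + n + 2))) := by
  obtain ⟨σ, hσ, h1⟩ := inUF_of_mem ι F hg (r.seq (k + n + 1))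
  have e0 := h n
  have e1 : g (r.seq (k + n + 1)) = s.seq (l + n + 1) := h (n + 1)
  have e2 : g (r.seq (k + n + 2)) = s.seq (l + n + 2) := h (n + 2)
  have h2 := h1 _ (r.adj (k + n)).symm
  have h3 := h1 _ (r.adj (k + n + 1))
  rw [e0, e1, ← ι.symm _ _ (r.adj _), ← ι.symm _ _ (s.adj _)] at h2
  rw [show k + n + 1 + 1 = k + n + 2 from rfl, e1, e2] at h3
  rw [← h2, ← h3, typ_iff F hσ]

/-- If `F` is transitive but not 2-transitive, any pattern is realized by a ray. -/
theorem exists_pattern (hT : T.IsTree) (ht : PermTransitive F) (h2 : ¬ PermTwoTransitive F) :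
    ∃ i j : Fin d, ∀ b : ℕ → Prop, ∃ r : GeodRay T, ∀ n,
      typ F i j (ι.color (r.seq n) (r.seq (n + 1))) (ι.color (r.seq (n + 1)) (r.seq (n + 2)))
        ↔ b n := by
  classical
  unfold PermTwoTransitive at h2
  push Not at h2
  obtain ⟨i, j, c, e, hij, hce, hno⟩ := h2
  refine ⟨i, j, fun b => ?_⟩
  have hstep : ∀ (x : Fin d) (P : Prop), ∃ y, x ≠ y ∧ (typ F i j x y ↔ P) := by
    intro x P
    by_cases hP : P
    · obtain ⟨σ, hσ, hx⟩ := ht i x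
      refine ⟨σ j, ?_, iff_of_true ⟨σ, hσ, hx, rfl⟩ hP⟩
      rw [← hx]; exact fun h => hij (σ.injective h)
    · obtain ⟨σ, hσ, hx⟩ := ht c x
      refine ⟨σ e, ?_, iff_of_false ?_ hP⟩
      · rw [← hx]; exact fun h => hce (σ.injective h)
      · rw [← hx, typ_iff F hσ]
        rintro ⟨τ, hτ, h3, h4⟩
        exact hno τ hτ h3 h4
  choose nx hnx1 hnx2 using hstep
  let x : ℕ → Fin d := fun n => Nat.rec i (fun n y => nx y (b n)) n
  have hx : ∀ n, x (n + 1) = nx (x n) (b n) := fun n => rfl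
  have := hT.connected.nonempty
  obtain ⟨a⟩ := this
  obtain ⟨r, -, hr⟩ := exists_color_ray ι hT a x (fun n => by rw [hx]; exact hnx1 _ _)
  refine ⟨r, fun n => ?_⟩
  rw [hr n, show n + 2 = n + 1 + 1 from rfl, hr (n + 1), hx]
  exact hnx2 _ _

theorem two_of_trans (hT : T.IsTree) (ht : PermTransitive F)
    (h : ∀ ξ η : GeodRay T, ∃ g ∈ UFplus T F ι, RayEquiv T (mapRay T g ξ) η) :
    PermTwoTransitive F := by
  by_contra h2
  obtain ⟨i, j, H⟩ := exists_pattern ι F hT ht h2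
  obtain ⟨r, hr⟩ := H (fun _ => True)
  obtain ⟨s, hs⟩ := H (fun _ => False)
  obtain ⟨g, hg, k, l, hkl⟩ := h r s
  have := typ_ray ι F hg i j r s k l hkl 0
  rw [hr, hs] at this
  exact this.2 trivial

theorem squares_aux (k l : ℕ) (hkl : k < l) (h : ∀ n, IsSquare (l + n) ↔ IsSquare (k + n)) :
    False := by
  have h1 := h (l * l - k)
  have h2 : k + (l * l - k) = l * l := by
    have : k ≤ l * l := by nlinarith
    omega
  rw [h2] at h1
  obtain ⟨m, hm⟩ := h1.2 ⟨l, rfl⟩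
  have h3 : l * l < m * m := by omega
  have h4 : m * m ≤ l * l + l := by omega
  have h5 : l < m := by nlinarith
  nlinarith

theorem two_of_hyp (hT : T.IsTree) (ht : PermTransitive F)
    (h : ∀ ξ : GeodRay T, ∃ g ∈ UFplus T F ι, FixesEnd T g ξ ∧ IsHyperbolic T g) :
    PermTwoTransitive F := by
  by_contra h2
  obtain ⟨i, j, H⟩ := exists_pattern ι F hT ht h2
  obtain ⟨r, hr⟩ := H IsSquare
  obtain ⟨g, hg, ⟨k, l, hkl⟩, hyp⟩ := h r
  have h3 : ∀ n, IsSquare (l + n) ↔ IsSquare (k + n) := fun n => by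
    have := typ_ray ι F hg i j r r k l hkl n
    rwa [hr, hr] at this
  rcases lt_trichotomy k l with h4 | h4 | h4
  · exact squares_aux k l h4 h3
  · subst h4
    have h5 : r.seq k = g (r.seq k) := (hkl 0).symm
    have h6 : transLen T g ≤ T.dist (r.seq k) (g (r.seq k)) := Nat.sInf_le ⟨_, rfl⟩
    rw [← h5, SimpleGraph.dist_self] at h6
    unfold IsHyperbolic at hyp
    omega
  · exact squares_aux l k h4 (fun n => (h3 n).symm)

end Helpers

/-- Let `F` be primitive but not cyclic of prime order and
`𝔾 = U(F)⁺`.  Then `𝔾` is transitive on `∂𝒯` iff every end stabilizer `𝔾_ξ` contains a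
hyperbolic element. -/
theorem end_transitive_iff_hyperbolic_in_end_stabilizers
    {V : Type} (T : SimpleGraph V) (d : ℕ) (hd : 3 ≤ d)
    (hT : T.IsTree) (hreg : Regular T d) (ι : LegalColoring T d)
    (F : Subgroup (Equiv.Perm (Fin d)))
    (hprim : PermPrimitive F) (hncyc : ¬ CyclicOfPrimeOrder F) :
    (∀ ξ η : GeodRay T, ∃ g ∈ UFplus T F ι, RayEquiv T (mapRay T g ξ) η) ↔
      ∀ ξ : GeodRay T, ∃ g ∈ UFplus T F ι, FixesEnd T g ξ ∧ IsHyperbolic T g := by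
  exact ⟨fun h ξ => hyp_of_two ι F hd hT (two_of_trans ι F hT hprim.1 h) ξ,
    fun h ξ η => trans_of_two ι F hd hT (two_of_hyp ι F hT hprim.1 h) ξ η⟩

end TreeHM
end

section
/- Let T be a locally finite tree and let α = (g_n) be a sequence in Aut(T). Assume there exist a vertex x ∈ T and an end ξ ∈ ∂T such that g_n(x) → ξ as n → ∞. Then every g ∈ Aut(T) that fixes pointwise the half-tree of T emanating from the vertex x and containing ξ in its boundary is an element of the contraction group U⁺_α. -/
open Filter Topology
open scoped InnerProductSpace

namespace TreeHM

variable {V : Type}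

theorem path_length_eq_dist (T : SimpleGraph V) (hT : T.IsTree) {u v : V} (p : T.Walk u v)
    (hp : p.IsPath) : T.dist u v = p.length := by
  obtain ⟨q, hq, hl⟩ := hT.connected.exists_path_of_dist u v
  have h := hT.IsAcyclic.path_unique ⟨p, hp⟩ ⟨q, hq⟩
  have h2 : p = q := congrArg Subtype.val h
  rw [h2, hl]

theorem side_of_close (T : SimpleGraph V) (hT : T.IsTree) {x a w z : V} (hxa : T.Adj x a)
    (hw : T.dist x w = 1 + T.dist a w) (hz : T.dist w z < T.dist x w) :
    T.dist x z = 1 + T.dist a z := by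
  classical
  obtain ⟨q, hq⟩ := hT.connected.exists_walk_length_eq_dist a w
  obtain ⟨p, hp⟩ := hT.connected.exists_walk_length_eq_dist w z
  have hxq : x ∉ q.support := by
    intro h
    have h1 := SimpleGraph.dist_le (q.dropUntil x h)
    have h2 := q.length_dropUntil_le_length h
    omega
  have hxp : x ∉ p.support := by
    intro h
    have h1 := SimpleGraph.dist_le (p.takeUntil x h)
    have h2 := p.length_takeUntil_le_length h
    rw [SimpleGraph.dist_comm] at h1
    omega
  have hb : x ∉ (q.append p).bypass.support := by
    intro h
    have h1 := (q.append p).support_bypass_subset_support h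
    rw [SimpleGraph.Walk.mem_support_append_iff] at h1
    tauto
  have hP := (q.append p).bypass_isPath
  have e1 := path_length_eq_dist T hT _ hP
  have e2 := path_length_eq_dist T hT (SimpleGraph.Walk.cons hxa (q.append p).bypass)
    (hP.cons hb)
  rw [SimpleGraph.Walk.length_cons] at e2
  omega

/-- Let `T` be a locally finite tree and `α = (g_n)` a sequence in
`Aut(T)`.  If `g_n(x) → ξ` for a vertex `x` and an end `ξ`, then every automorphism
fixing pointwise the half-tree emanating from `x` and containing `ξ` in its boundary
belongs to the contraction group `U⁺_α`. -/
theorem halfTree_fixator_mem_contraction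
    {V : Type} (T : SimpleGraph V) (hT : T.IsTree) (hlf : LocFin T)
    (α : ℕ → (T ≃g T)) (x : V) (ξ : GeodRay T) (hbase : ξ.seq 0 = x)
    (hconv : TendstoEnd T (fun n : ℕ => (α n) x) ξ) :
    ∀ g : T ≃g T, (∀ y ∈ RaySide T ξ, g y = y) → g ∈ ContrSeq α := by
  intro g hg
  subst hbase
  have key : ∀ y : V, ∀ᶠ n in atTop, ((α n)⁻¹ * g * α n) y = y := by
    intro y
    filter_upwards [hconv 1, hconv (T.dist (ξ.seq 0) y + 1)] with n h1 h2
    have hz : T.dist (α n (ξ.seq 0)) (α n y) < T.dist (ξ.seq 0) (α n (ξ.seq 0)) := by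
      rw [iso_dist_eq]
      omega
    have hs := side_of_close T hT (ξ.adj 0) h1 hz
    have hf : g (α n y) = α n y := hg _ (Or.inr hs)
    change (α n)⁻¹ (g (α n y)) = y
    rw [hf]
    exact (α n).symm_apply_apply y
  letI : TopologicalSpace V := ⊥
  haveI : DiscreteTopology V := ⟨rfl⟩
  change Tendsto (fun n : ℕ => (α n)⁻¹ * g * α n) atTop (𝓝 1)
  rw [nhds_induced, tendsto_comap_iff, tendsto_pi_nhds]
  intro y
  refine tendsto_nhds_of_eventually_eq ?_
  exact key y

end TreeHM
end

section
/- Let d ≥ 3, let F ≤ Sym({1,…,d}) be primitive but not cyclic of prime order, and set 𝔾 = U(F)⁺. Then for every hyperbolic element a ∈ 𝔾, the group 𝔾 is generated by the two contraction groups U⁺_a and U⁻_a, i.e. 𝔾 = ⟨U⁺_a, U⁻_a⟩. -/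
open Filter Topology
open scoped InnerProductSpace

namespace TreeHM

variable {V : Type}

theorem tr_T2 {T : SimpleGraph V} (hT : T.IsTree) {u v w w' : V} (h : T.Adj v w) (h' : T.Adj v w')
    (hw : T.dist u v = T.dist u w + 1) (hw' : T.dist u v = T.dist u w' + 1) : w = w' := by
  have key : ∀ z : V, T.Adj v z → T.dist u v = T.dist u z + 1 →
      ∃ p : T.Walk v u, p.IsPath ∧ p.snd = z := by
    intro z hz hd
    obtain ⟨q, hq⟩ := hT.connected.exists_walk_length_eq_dist z u
    refine ⟨SimpleGraph.Walk.cons hz q, ?_, by simp⟩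
    apply SimpleGraph.Walk.isPath_of_length_eq_dist
    rw [SimpleGraph.Walk.length_cons, hq, T.dist_comm (u := v), hd, T.dist_comm]
  obtain ⟨p, hp, rfl⟩ := key w h hw
  obtain ⟨p', hp', rfl⟩ := key w' h' hw'
  rw [(hT.existsUnique_path v u).unique hp hp']

theorem tr_T1 {T : SimpleGraph V} (hT : T.IsTree) (u : V) {v w : V} (h : T.Adj v w) :
    T.dist u v = T.dist u w + 1 ∨ T.dist u w = T.dist u v + 1 := by
  have := hT.dist_eq_dist_add_one_of_adj u h
  omega

/-- existence of closer neighbour -/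
theorem tr_ex {T : SimpleGraph V} (hT : T.IsTree) {u v : V} (h : v ≠ u) :
    ∃ w, T.Adj v w ∧ T.dist u v = T.dist u w + 1 := by
  obtain ⟨p, hp⟩ := hT.connected.exists_walk_length_eq_dist v u
  cases p with
  | nil => exact absurd rfl h
  | @cons _ w _ hw q =>
    refine ⟨w, hw, ?_⟩
    have h1 := SimpleGraph.dist_le q
    rw [SimpleGraph.Walk.length_cons] at hp
    rw [T.dist_comm] at h1 hp
    have := tr_T1 hT u hw
    omega

theorem tr_parity {T : SimpleGraph V} (hT : T.IsTree) (u : V) {v w : V} (p : T.Walk v w) :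
    Even (T.dist u v + T.dist u w + p.length) := by
  induction p with
  | nil => simp
  | cons h q ih =>
    rw [SimpleGraph.Walk.length_cons]
    have := tr_T1 hT u h
    rw [Nat.even_iff] at *
    omega

theorem tr_parity' {T : SimpleGraph V} (hT : T.IsTree) (u v w : V) :
    Even (T.dist u v + T.dist u w + T.dist v w) := by
  obtain ⟨p, hp⟩ := hT.connected.exists_walk_length_eq_dist v w
  rw [← hp]; exact tr_parity hT u p

theorem side_or {T : SimpleGraph V} (hT : T.IsTree) {x y : V} (h : T.Adj x y) (v : V) :
    v ∈ EdgeSide T x y ∨ v ∈ EdgeSide T y x := by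
  have := tr_T1 hT v h
  simp only [EdgeSide, Set.mem_ofPred_eq, T.dist_comm (v := v)]
  omega

theorem side_not {T : SimpleGraph V} {x y : V} {v : V}
    (h1 : v ∈ EdgeSide T x y) (h2 : v ∈ EdgeSide T y x) : False := by
  simp only [EdgeSide, Set.mem_ofPred_eq] at *
  omega

theorem side_cross {T : SimpleGraph V} (hT : T.IsTree) {x y v w : V} (h : T.Adj x y)
    (hv : v ∈ EdgeSide T x y) (hw : w ∈ EdgeSide T y x) (hvw : T.Adj v w) : v = x ∧ w = y := by
  simp only [EdgeSide, Set.mem_ofPred_eq] at *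
  have h1 := tr_T1 hT x hvw
  have h2 := tr_T1 hT y hvw
  have hx : v = x := by
    by_contra hne
    obtain ⟨z, hz, hd⟩ := tr_ex hT hne
    have h3 := tr_T1 hT z h
    rw [T.dist_comm (u := z) (v := x), T.dist_comm (u := z) (v := y)] at h3
    have h4 := tr_T1 hT y hz
    have : z = w := tr_T2 hT (u := y) hz hvw (by omega) (by omega)
    subst this
    omega
  refine ⟨hx, ?_⟩
  subst hx
  have : T.dist y w = 0 := by
    rw [SimpleGraph.dist_self] at *
    omega
  exact ((hT.connected.dist_eq_zero_iff).1 this).symm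

theorem side_walk {T : SimpleGraph V} (hT : T.IsTree) {x y : V} (h : T.Adj x y) {v w : V}
    (p : T.Walk v w) (hv : v ∈ EdgeSide T x y) (hw : w ∈ EdgeSide T y x) :
    T.dist v x + 1 + T.dist y w ≤ p.length := by
  induction p with
  | nil => exact (side_not hv hw).elim
  | @cons a b c hab q ih =>
    rw [SimpleGraph.Walk.length_cons]
    rcases side_or hT h b with hb | hb
    · have := ih hb hw
      have := tr_T1 hT x hab
      rw [T.dist_comm, T.dist_comm (u := x) (v := b)] at this
      omega
    · obtain ⟨rfl, rfl⟩ := side_cross hT h hv hb hab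
      have := SimpleGraph.dist_le q
      simp only [SimpleGraph.dist_self]
      omega

theorem side_dist {T : SimpleGraph V} (hT : T.IsTree) {x y : V} (h : T.Adj x y) {v w : V}
    (hv : v ∈ EdgeSide T x y) (hw : w ∈ EdgeSide T y x) :
    T.dist v w = T.dist v x + 1 + T.dist y w := by
  apply le_antisymm
  · have h1 := hT.connected.dist_triangle (u := v) (v := x) (w := w)
    simp only [EdgeSide, Set.mem_ofPred_eq] at hw
    omega
  · obtain ⟨p, hp⟩ := hT.connected.exists_walk_length_eq_dist v w
    rw [← hp]; exact side_walk hT h p hv hw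

theorem side_left {T : SimpleGraph V} {x y : V} (h : T.Adj x y) : x ∈ EdgeSide T x y := by
  simp only [EdgeSide, Set.mem_ofPred_eq, SimpleGraph.dist_self]
  exact SimpleGraph.dist_eq_one_iff_adj.2 h.symm

theorem side_map {T : SimpleGraph V} (g : T ≃g T) {x y v : V} :
    g v ∈ EdgeSide T (g x) (g y) ↔ v ∈ EdgeSide T x y := by
  simp only [EdgeSide, Set.mem_ofPred_eq, iso_dist_eq]

/-! InUF -/

theorem inUF_mul {d : ℕ} {T : SimpleGraph V} {F : Subgroup (Equiv.Perm (Fin d))}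
    {ι : LegalColoring T d} {g h : T ≃g T} (hg : InUF T F ι g) (hh : InUF T F ι h) :
    InUF T F ι (g * h) := by
  intro x
  obtain ⟨σ, hσ, h1⟩ := hh x
  obtain ⟨τ, hτ, h2⟩ := hg (h x)
  refine ⟨τ * σ, F.mul_mem hτ hσ, fun y hy => ?_⟩
  rw [Equiv.Perm.mul_apply, h1 y hy, h2 (h y) (h.map_adj_iff.2 hy)]
  rfl

theorem g_inv_apply {T : SimpleGraph V} (g : T ≃g T) (v : V) : g (g⁻¹ v) = v :=
  g.apply_symm_apply v

theorem g_apply_inv {T : SimpleGraph V} (g : T ≃g T) (v : V) : g⁻¹ (g v) = v :=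
  g.symm_apply_apply v

theorem g_mul {T : SimpleGraph V} (g h : T ≃g T) (v : V) : (g * h) v = g (h v) := rfl

theorem inUF_inv {d : ℕ} {T : SimpleGraph V} {F : Subgroup (Equiv.Perm (Fin d))}
    {ι : LegalColoring T d} {g : T ≃g T} (hg : InUF T F ι g) :
    InUF T F ι g⁻¹ := by
  intro x
  obtain ⟨σ, hσ, h1⟩ := hg (g⁻¹ x)
  refine ⟨σ⁻¹, F.inv_mem hσ, fun y hy => ?_⟩
  rw [Equiv.Perm.inv_eq_iff_eq, h1 (g⁻¹ y) ((g⁻¹).map_adj_iff.2 hy)]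
  simp only [g_inv_apply]

/-! Tits independence -/

open Classical in
theorem tits {d : ℕ} {T : SimpleGraph V} (hT : T.IsTree) {F : Subgroup (Equiv.Perm (Fin d))}
    {ι : LegalColoring T d} {x y : V} (hxy : T.Adj x y) {g : T ≃g T} (hg : InUF T F ι g)
    (hx : g x = x) (hy : g y = y) :
    ∃ g₁ : T ≃g T, InUF T F ι g₁ ∧ (∀ v ∈ EdgeSide T x y, g₁ v = v) ∧
      (∀ v ∈ EdgeSide T y x, g₁ v = g v) := by
  have hxi : g⁻¹ x = x := by conv_lhs => rw [← hx, g_apply_inv]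
  have hyi : g⁻¹ y = y := by conv_lhs => rw [← hy, g_apply_inv]
  have hgs : ∀ v, g v ∈ EdgeSide T x y ↔ v ∈ EdgeSide T x y := by
    intro v
    conv_lhs => rw [← hx, ← hy]
    exact side_map g
  have hgsi : ∀ v, g⁻¹ v ∈ EdgeSide T x y ↔ v ∈ EdgeSide T x y := by
    intro v
    rw [← hgs, g_inv_apply]
  let f : V → V := fun v => if v ∈ EdgeSide T x y then v else g v
  let f' : V → V := fun v => if v ∈ EdgeSide T x y then v else g⁻¹ v
  have fS : ∀ v ∈ EdgeSide T x y, f v = v := fun v hv => if_pos hv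
  have fS' : ∀ v ∈ EdgeSide T y x, f v = g v := fun v hv => if_neg (fun h => side_not h hv)
  have fy : f y = y := by rw [fS' y (side_left hxy.symm), hy]
  have fx : f x = x := fS x (side_left hxy)
  have key : ∀ v w, T.Adj v w → (f v = v ∧ f w = w) ∨ (f v = g v ∧ f w = g w) := by
    intro v w hvw
    rcases side_or hT hxy v with hv | hv <;> rcases side_or hT hxy w with hw | hw
    · exact Or.inl ⟨fS _ hv, fS _ hw⟩
    · obtain ⟨rfl, rfl⟩ := side_cross hT hxy hv hw hvw
      exact Or.inl ⟨fx, fy⟩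
    · obtain ⟨rfl, rfl⟩ := side_cross hT hxy hw hv hvw.symm
      exact Or.inl ⟨fy, fx⟩
    · exact Or.inr ⟨fS' _ hv, fS' _ hw⟩
  have hl : Function.LeftInverse f' f := by
    intro v
    by_cases hv : v ∈ EdgeSide T x y
    · simp [f, f', hv]
    · simp [f, f', hv, hgs, g_apply_inv]
  have hr : Function.RightInverse f' f := by
    intro v
    by_cases hv : v ∈ EdgeSide T x y
    · simp [f, f', hv]
    · simp [f, f', hv, hgsi, g_inv_apply]
  have hadj : ∀ v w, T.Adj v w → T.Adj (f v) (f w) := by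
    intro v w hvw
    rcases key v w hvw with ⟨h1, h2⟩ | ⟨h1, h2⟩ <;> rw [h1, h2]
    · exact hvw
    · exact g.map_adj_iff.2 hvw
  have hadj' : ∀ v w, T.Adj v w → T.Adj (f' v) (f' w) := by
    intro v w hvw
    have e : ∀ z, f z = z ∨ f z = g z := by
      intro z
      by_cases hz : z ∈ EdgeSide T x y
      · left; exact if_pos hz
      · right; exact if_neg hz
    rcases side_or hT hxy v with hv | hv <;> rcases side_or hT hxy w with hw | hw
    · simpa [f', hv, hw] using hvw
    · obtain ⟨rfl, rfl⟩ := side_cross hT hxy hv hw hvw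
      have : f' w = w := by
        have := hl w; rwa [fy] at this
      rw [this]
      simpa [f', hv] using hvw
    · obtain ⟨rfl, rfl⟩ := side_cross hT hxy hw hv hvw.symm
      have : f' v = v := by
        have := hl v; rwa [fy] at this
      rw [this]
      simpa [f', hw] using hvw
    · have hv' : v ∉ EdgeSide T x y := fun h => side_not h hv
      have hw' : w ∉ EdgeSide T x y := fun h => side_not h hw
      simp only [f', hv', hw', if_false]
      exact (g⁻¹).map_adj_iff.2 hvw
  let g₁ : T ≃g T := ⟨⟨f, f', hl, hr⟩, by
    intro v w
    refine ⟨fun h => ?_, hadj v w⟩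
    have := hadj' _ _ h
    simp only [Equiv.coe_fn_mk] at this
    rwa [hl v, hl w] at this⟩
  have hg₁ : ∀ v, g₁ v = f v := fun v => rfl
  refine ⟨g₁, ?_, fS, fS'⟩
  intro v
  rcases side_or hT hxy v with hv | hv
  · refine ⟨1, F.one_mem, fun w hvw => ?_⟩
    have hw : f w = w := by
      rcases side_or hT hxy w with hw | hw
      · exact fS _ hw
      · obtain ⟨rfl, rfl⟩ := side_cross hT hxy hv hw hvw
        exact fy
    rw [hg₁, hg₁, hw, fS _ hv]; rfl
  · obtain ⟨σ, hσ, h⟩ := hg v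
    refine ⟨σ, hσ, fun w hvw => ?_⟩
    have hw : f w = g w := by
      rcases side_or hT hxy w with hw | hw
      · obtain ⟨rfl, rfl⟩ := side_cross hT hxy hw hv hvw.symm
        rw [fx, hx]
      · exact fS' _ hw
    rw [hg₁, hg₁, hw, fS' _ hv]
    exact h w hvw

/-! Extension of local permutations -/

open Classical in
theorem ext_hom {d : ℕ} {T : SimpleGraph V} (hT : T.IsTree) (ι : LegalColoring T d)
    (σ : Equiv.Perm (Fin d)) (x : V) :
    ∃ f : V → V, f x = x ∧ ∀ u v, T.Adj u v →
      T.Adj (f u) (f v) ∧ ι.color (f u) (f v) = σ (ι.color u v) := by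
  have hn : ∀ (u : V) (c : Fin d), ∃ w, T.Adj u w ∧ ι.color u w = c := by
    intro u c
    obtain ⟨w, hw, hc⟩ := ι.surjOn u (Set.mem_univ c)
    exact ⟨w, hw, hc⟩
  choose nbr nadj ncol using hn
  have hp : ∀ v : V, ∃ w, v ≠ x → T.Adj v w ∧ T.dist x v = T.dist x w + 1 := by
    intro v
    by_cases h : v = x
    · exact ⟨v, fun h' => absurd h h'⟩
    · obtain ⟨w, hw⟩ := tr_ex hT h
      exact ⟨w, fun _ => hw⟩
  choose par hpar using hp
  let Φ : ℕ → V → V := fun n => Nat.rec (fun _ => x)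
    (fun _ ih v => nbr (ih (par v)) (σ (ι.color (par v) v))) n
  let f : V → V := fun v => Φ (T.dist x v) v
  have fx : f x = x := by simp [f, Φ]
  have fstep : ∀ v, v ≠ x → f v = nbr (f (par v)) (σ (ι.color (par v) v)) := by
    intro v hv
    have h := (hpar v hv).2
    simp only [f]
    rw [h]
  have main : ∀ u v, T.Adj u v → T.dist x v = T.dist x u + 1 →
      T.Adj (f u) (f v) ∧ ι.color (f u) (f v) = σ (ι.color u v) := by
    intro u v huv hd
    have hv : v ≠ x := by rintro rfl; simp at hd
    have : par v = u := tr_T2 hT (hpar v hv).1 huv.symm (hpar v hv).2 hd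
    rw [fstep v hv, this]
    exact ⟨nadj _ _, ncol _ _⟩
  refine ⟨f, fx, fun u v huv => ?_⟩
  rcases tr_T1 hT x huv with h | h
  · obtain ⟨h1, h2⟩ := main v u huv.symm h
    refine ⟨h1.symm, ?_⟩
    rw [ι.symm _ _ h1.symm, h2, ι.symm _ _ huv]
  · exact main u v huv h

theorem col_rigid {d : ℕ} {T : SimpleGraph V} (hT : T.IsTree) (ι : LegalColoring T d)
    (f : V → V) {x : V} (hx : f x = x)
    (h : ∀ u v, T.Adj u v → T.Adj (f u) (f v) ∧ ι.color (f u) (f v) = ι.color u v) (v : V) :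
    f v = v := by
  obtain ⟨p⟩ := hT.connected.preconnected x v
  induction p with
  | nil => exact hx
  | @cons a b c hab q ih =>
    apply ih
    obtain ⟨h1, h2⟩ := h a b hab
    rw [hx] at h1 h2
    exact ι.injOn a h1 hab h2

theorem ext_iso {d : ℕ} {T : SimpleGraph V} (hT : T.IsTree) (ι : LegalColoring T d)
    (F : Subgroup (Equiv.Perm (Fin d))) (σ : Equiv.Perm (Fin d)) (hσ : σ ∈ F) (x : V) :
    ∃ g : T ≃g T, InUF T F ι g ∧ g x = x ∧
      ∀ y, T.Adj x y → ι.color x (g y) = σ (ι.color x y) := by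
  obtain ⟨f, fx, hf⟩ := ext_hom hT ι σ x
  obtain ⟨f', fx', hf'⟩ := ext_hom hT ι σ⁻¹ x
  have hl : ∀ v, f' (f v) = v := by
    refine col_rigid hT ι (fun v => f' (f v)) (x := x) (by simp [fx, fx']) ?_
    intro u v huv
    obtain ⟨h1, h2⟩ := hf u v huv
    obtain ⟨h3, h4⟩ := hf' _ _ h1
    exact ⟨h3, by rw [h4, h2]; simp⟩
  have hr : ∀ v, f (f' v) = v := by
    refine col_rigid hT ι (fun v => f (f' v)) (x := x) (by simp [fx, fx']) ?_
    intro u v huv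
    obtain ⟨h1, h2⟩ := hf' u v huv
    obtain ⟨h3, h4⟩ := hf _ _ h1
    exact ⟨h3, by rw [h4, h2]; simp⟩
  let g : T ≃g T := ⟨⟨f, f', hl, hr⟩, by
    intro v w
    refine ⟨fun h => ?_, fun h => (hf v w h).1⟩
    have := (hf' _ _ h).1
    simp only [Equiv.coe_fn_mk] at this
    rwa [hl v, hl w] at this⟩
  have hg : ∀ v, g v = f v := fun v => rfl
  refine ⟨g, ?_, fx, ?_⟩
  · intro v
    exact ⟨σ, hσ, fun y hy => ((hf v y hy).2).symm⟩
  · intro y hy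
    have := (hf x y hy).2
    rwa [fx] at this

/-! Primitive groups -/

theorem prim_orbit {d : ℕ} {F : Subgroup (Equiv.Perm (Fin d))} (hprim : PermPrimitive F)
    (K : Subgroup (Equiv.Perm (Fin d))) (hK : K ≤ F) (i : Fin d)
    (hi : ∀ σ ∈ F, σ i = i → σ ∈ K) : (∀ σ ∈ K, σ i = i) ∨ K = F := by
  have hb := hprim.2 {k | ∃ τ ∈ K, τ i = k} (by
    intro σ hσ
    by_cases hd : Disjoint (σ '' {k | ∃ τ ∈ K, τ i = k}) {k | ∃ τ ∈ K, τ i = k}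
    · exact Or.inr hd
    · left
      rw [Set.not_disjoint_iff] at hd
      obtain ⟨_, ⟨_, ⟨τ, hτ, rfl⟩, rfl⟩, ⟨τ', hτ', h⟩⟩ := hd
      have h1 : τ'⁻¹ * σ * τ ∈ K := by
        apply hi
        · exact F.mul_mem (F.mul_mem (F.inv_mem (hK hτ')) hσ) (hK hτ)
        · rw [Equiv.Perm.mul_apply, Equiv.Perm.mul_apply, ← h]; simp
      have hσK : σ ∈ K := by
        have := K.mul_mem (K.mul_mem hτ' h1) (K.inv_mem hτ)
        simpa [mul_assoc] using this
      ext k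
      constructor
      · rintro ⟨_, ⟨ρ, hρ, rfl⟩, rfl⟩
        exact ⟨σ * ρ, K.mul_mem hσK hρ, rfl⟩
      · rintro ⟨ρ, hρ, rfl⟩
        exact ⟨σ⁻¹ (ρ i), ⟨σ⁻¹ * ρ, K.mul_mem (K.inv_mem hσK) hρ, rfl⟩, by simp⟩)
  rcases hb with hb | hb
  · left
    intro σ hσ
    exact hb ⟨σ, hσ, rfl⟩ ⟨1, K.one_mem, rfl⟩
  · right
    refine le_antisymm hK fun σ hσ => ?_
    have : σ i ∈ {k | ∃ τ ∈ K, τ i = k} := by rw [hb]; trivial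
    obtain ⟨τ, hτ, h⟩ := this
    have h1 : τ⁻¹ * σ ∈ K := by
      apply hi _ (F.mul_mem (F.inv_mem (hK hτ)) hσ)
      rw [Equiv.Perm.mul_apply, ← h]; simp
    simpa using K.mul_mem hτ h1

theorem prim_stab_ne {d : ℕ} (hd : 3 ≤ d) {F : Subgroup (Equiv.Perm (Fin d))}
    (hprim : PermPrimitive F)
    (hncyc : ¬ CyclicOfPrimeOrder F) {i j : Fin d} (hij : i ≠ j)
    (h : ∀ σ ∈ F, σ i = i ↔ σ j = j) : False := by
  have hconj : ∀ τ ∈ F, ∀ k, (∀ σ ∈ F, σ i = i ↔ σ k = k) →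
      ∀ σ ∈ F, (τ⁻¹ * σ * τ) i = i ↔ σ (τ k) = τ k := by
    intro τ hτ k hk σ hσ
    rw [hk _ (F.mul_mem (F.mul_mem (F.inv_mem hτ) hσ) hτ)]
    rw [Equiv.Perm.mul_apply, Equiv.Perm.mul_apply, Equiv.Perm.inv_eq_iff_eq]
  have hC := hprim.2 {k | ∀ σ ∈ F, σ i = i ↔ σ k = k} (by
    intro τ hτ
    by_cases hd : Disjoint (τ '' {k | ∀ σ ∈ F, σ i = i ↔ σ k = k})
      {k | ∀ σ ∈ F, σ i = i ↔ σ k = k}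
    · exact Or.inr hd
    · left
      rw [Set.not_disjoint_iff] at hd
      obtain ⟨_, ⟨k, hk, rfl⟩, hk'⟩ := hd
      have h1 : ∀ σ ∈ F, (τ⁻¹ * σ * τ) i = i ↔ σ i = i := fun σ hσ =>
        (hconj τ hτ k hk σ hσ).trans (hk' σ hσ).symm
      have h2 : τ '' {k | ∀ σ ∈ F, σ i = i ↔ σ k = k} ⊆ {k | ∀ σ ∈ F, σ i = i ↔ σ k = k} := by
        rintro _ ⟨c, hc, rfl⟩ σ hσ
        exact (h1 σ hσ).symm.trans (hconj τ hτ c hc σ hσ)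
      apply Set.eq_of_subset_of_ncard_le h2
      rw [Set.ncard_image_of_injective _ τ.injective])
  have htriv : ∀ σ ∈ F, σ i = i → σ = 1 := by
    rcases hC with hC | hC
    · exact absurd (hC (show i ∈ _ from fun σ _ => Iff.rfl) (show j ∈ _ from h)) hij
    · intro σ hσ hi
      ext k
      have : k ∈ {k | ∀ σ ∈ F, σ i = i ↔ σ k = k} := by rw [hC]; trivial
      rw [(this σ hσ).1 hi]; rfl
  have hdich : ∀ K : Subgroup (Equiv.Perm (Fin d)), K ≤ F → K = ⊥ ∨ K = F := by
    intro K hK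
    rcases prim_orbit hprim K hK i (fun σ hσ hi => by rw [htriv σ hσ hi]; exact K.one_mem) with h | h
    · left
      rw [Subgroup.eq_bot_iff_forall]
      exact fun σ hσ => htriv σ (hK hσ) (h σ hσ)
    · exact Or.inr h
  obtain ⟨ρ, hρ, hρi⟩ := hprim.1 i j
  have hcard : Nat.card F ≠ 1 := by
    intro h1
    have := Subgroup.eq_bot_of_card_eq F h1
    rw [this, Subgroup.mem_bot] at hρ
    rw [hρ] at hρi
    exact hij hρi
  obtain ⟨p, hp, hpd⟩ := Nat.exists_prime_and_dvd hcard
  haveI := Fact.mk hp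
  obtain ⟨s, hs⟩ := exists_prime_orderOf_dvd_card' p hpd
  have hF : Nat.card F = p := by
    rcases hdich (Subgroup.zpowers (s : Equiv.Perm (Fin d)))
      (by rw [Subgroup.zpowers_le]; exact s.2) with h | h
    · rw [Subgroup.zpowers_eq_bot] at h
      have : s = 1 := Subtype.ext h
      rw [this, orderOf_one] at hs
      exact absurd hs.symm hp.one_lt.ne'
    · rw [← h, Nat.card_zpowers, Subgroup.orderOf_coe, hs]
  exact hncyc ⟨isCyclic_of_prime_card hF, hF ▸ hp⟩

theorem prim_gen {d : ℕ} (hd : 3 ≤ d) {F : Subgroup (Equiv.Perm (Fin d))}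
    (hprim : PermPrimitive F)
    (hncyc : ¬ CyclicOfPrimeOrder F) {i j : Fin d} (hij : i ≠ j)
    (K : Subgroup (Equiv.Perm (Fin d))) (hK : K ≤ F)
    (hi : ∀ σ ∈ F, σ i = i → σ ∈ K) (hj : ∀ σ ∈ F, σ j = j → σ ∈ K) : K = F := by
  rcases prim_orbit hprim K hK i hi with h | h
  · rcases prim_orbit hprim K hK j hj with h' | h'
    · exact (prim_stab_ne hd hprim hncyc hij fun σ hσ =>
        ⟨fun e => h' σ (hi σ hσ e), fun e => h σ (hj σ hσ e)⟩).elim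
    · exact h'
  · exact h

/-! vertex stabilizers -/

theorem vertex_gen {d : ℕ} (hd : 3 ≤ d) {T : SimpleGraph V} (hT : T.IsTree)
    (ι : LegalColoring T d) {F : Subgroup (Equiv.Perm (Fin d))}
    (hprim : PermPrimitive F) (hncyc : ¬ CyclicOfPrimeOrder F)
    (H : Subgroup (T ≃g T)) {x p q : V} (hp : T.Adj x p) (hq : T.Adj x q) (hpq : p ≠ q)
    (h1 : ∀ g, InUF T F ι g → g x = x → g p = p → g ∈ H)
    (h2 : ∀ g, InUF T F ι g → g x = x → g q = q → g ∈ H) :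
    ∀ g, InUF T F ι g → g x = x → g ∈ H := by
  let K : Subgroup (Equiv.Perm (Fin d)) :=
    { carrier := {σ | σ ∈ F ∧ ∃ g ∈ H, InUF T F ι g ∧ g x = x ∧
        ∀ y, T.Adj x y → ι.color x (g y) = σ (ι.color x y)}
      one_mem' := ⟨F.one_mem, 1, H.one_mem, fun v => ⟨1, F.one_mem, fun _ _ => rfl⟩, rfl,
        fun _ _ => rfl⟩
      mul_mem' := by
        rintro σ τ ⟨hσ, g, hg, hgu, hgx, hgc⟩ ⟨hτ, k, hk, hku, hkx, hkc⟩
        refine ⟨F.mul_mem hσ hτ, g * k, H.mul_mem hg hk, inUF_mul hgu hku, ?_, ?_⟩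
        · rw [g_mul, hkx, hgx]
        · intro y hy
          have : T.Adj x (k y) := by
            have := k.map_adj_iff.2 hy
            rwa [hkx] at this
          rw [g_mul, hgc _ this, hkc _ hy]; rfl
      inv_mem' := by
        rintro σ ⟨hσ, g, hg, hgu, hgx, hgc⟩
        have hx' : g⁻¹ x = x := by conv_lhs => rw [← hgx, g_apply_inv]
        refine ⟨F.inv_mem hσ, g⁻¹, H.inv_mem hg, inUF_inv hgu, hx', ?_⟩
        intro y hy
        have : T.Adj x (g⁻¹ y) := by
          have := (g⁻¹).map_adj_iff.2 hy
          rwa [hx'] at this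
        rw [eq_comm, Equiv.Perm.inv_eq_iff_eq, ← hgc _ this, g_inv_apply] }
  have adjfix : ∀ (g : T ≃g T), g x = x → ∀ y, T.Adj x y → T.Adj x (g y) := by
    intro g hg y hy
    have := g.map_adj_iff.2 hy
    rwa [hg] at this
  have hsub : ∀ r, T.Adj x r → (∀ g, InUF T F ι g → g x = x → g r = r → g ∈ H) →
      ∀ σ ∈ F, σ (ι.color x r) = ι.color x r → σ ∈ K := by
    intro r hr hH σ hσ hσr
    obtain ⟨g, hgu, hgx, hgc⟩ := ext_iso hT ι F σ hσ x
    refine ⟨hσ, g, hH g hgu hgx ?_, hgu, hgx, hgc⟩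
    apply ι.injOn x (adjfix g hgx r hr) hr
    rw [hgc r hr, hσr]
  have hne : ι.color x p ≠ ι.color x q := fun h => hpq (ι.injOn x hp hq h)
  have hKF : K = F := prim_gen hd hprim hncyc hne K (fun σ h => h.1) (hsub p hp h1) (hsub q hq h2)
  intro g hgu hgx
  obtain ⟨σ, hσ, hc⟩ := hgu x
  have hσK : σ ∈ K := hKF ▸ hσ
  obtain ⟨-, k, hk, hku, hkx, hkc⟩ := hσK
  have hkx' : k⁻¹ x = x := by conv_lhs => rw [← hkx, g_apply_inv]
  have : k⁻¹ * g ∈ H := by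
    apply h1 _ (inUF_mul (inUF_inv hku) hgu)
    · rw [g_mul, hgx, hkx']
    · have : g p = k p := by
        apply ι.injOn x (adjfix g hgx p hp) (adjfix k hkx p hp)
        have := hc p hp
        rw [hgx] at this
        rw [hkc p hp, this]
      rw [g_mul, this, g_apply_inv]
  simpa using H.mul_mem hk this

theorem all_gen {d : ℕ} {T : SimpleGraph V} (hT : T.IsTree)
    (ι : LegalColoring T d) {F : Subgroup (Equiv.Perm (Fin d))}
    (hprim : PermPrimitive F)
    (H : Subgroup (T ≃g T)) {x y : V} (hxy : T.Adj x y)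
    (h1 : ∀ g, InUF T F ι g → g x = x → g ∈ H)
    (h2 : ∀ g, InUF T F ι g → g y = y → g ∈ H) (v : V) :
    ∀ g, InUF T F ι g → g v = v → g ∈ H := by
  have step : ∀ x y, T.Adj x y → (∀ g, InUF T F ι g → g x = x → g ∈ H) →
      (∀ g, InUF T F ι g → g y = y → g ∈ H) → ∀ z, T.Adj x z →
      (∀ g, InUF T F ι g → g z = z → g ∈ H) := by
    intro x y hxy h1 h2 z hz g hg hgz
    obtain ⟨σ, hσ, hc⟩ := hprim.1 (ι.color x y) (ι.color x z)
    obtain ⟨k, hku, hkx, hkc⟩ := ext_iso hT ι F σ hσ x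
    have hkH : k ∈ H := h1 k hku hkx
    have hky : k y = z := by
      have := k.map_adj_iff.2 hxy
      rw [hkx] at this
      apply ι.injOn x this hz
      rw [hkc y hxy, hc]
    have : k⁻¹ * (g * k) ∈ H := by
      apply h2 _ (inUF_mul (inUF_inv hku) (inUF_mul hg hku))
      rw [g_mul, g_mul, hky, hgz, ← hky, g_apply_inv]
    have := H.mul_mem (H.mul_mem hkH this) (H.inv_mem hkH)
    simpa [mul_assoc] using this
  obtain ⟨p⟩ := hT.connected.preconnected x v
  induction p generalizing y with
  | nil => exact h1
  | @cons a b c hab q ih => exact ih hab.symm (step a y hxy h1 h2 b hab) h1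

/-! axis -/

/-- axis edge -/
theorem axis_nested {T : SimpleGraph V} (hT : T.IsTree) {a : T ≃g T} {p q : V} (h : T.Adj p q)
    (hax : T.dist p (a q) = T.dist q (a p) + 2) {v : V} (hv : v ∈ EdgeSide T q p) :
    a v ∈ EdgeSide T q p := by
  have h' : T.Adj (a p) (a q) := a.map_adj_iff.2 h
  have c1 := tr_T1 hT (a p) h
  have c2 := tr_T1 hT (a q) h
  have c3 := tr_T1 hT p h'
  have c4 := tr_T1 hT q h'
  rw [T.dist_comm (u := a p), T.dist_comm (u := a p)] at c1
  rw [T.dist_comm (u := a q), T.dist_comm (u := a q)] at c2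
  rcases side_or hT h (a v) with hs | hs
  · have e1 : a p ∈ EdgeSide T q p := by
      simp only [EdgeSide, Set.mem_ofPred_eq]; omega
    have e2 : a q ∈ EdgeSide T q p := by
      simp only [EdgeSide, Set.mem_ofPred_eq]; omega
    have d1 := side_dist hT h hs e1
    have d2 := side_dist hT h hs e2
    have := (side_map a).2 hv
    simp only [EdgeSide, Set.mem_ofPred_eq] at this
    rw [T.dist_comm, T.dist_comm (u := a q)] at this
    omega
  · exact hs

theorem axis_enter {T : SimpleGraph V} (hT : T.IsTree) {a : T ≃g T} {p q : V} (h : T.Adj p q)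
    (hax : T.dist p (a q) = T.dist q (a p) + 2) (v : V) :
    ∀ᶠ n : ℕ in atTop, (a ^ n) v ∈ EdgeSide T q p := by
  have ex : ∃ n : ℕ, (a ^ n) v ∈ EdgeSide T q p := by
    by_contra hno
    push Not at hno
    have hin : ∀ n : ℕ, (a ^ n) v ∈ EdgeSide T p q := fun n =>
      (side_or hT h _).resolve_right (hno n)
    have dec : ∀ n : ℕ, T.dist ((a ^ (n+1)) v) q < T.dist ((a ^ n) v) q := by
      intro n
      have e2 : a q ∈ EdgeSide T q p := axis_nested hT h hax (side_left h.symm)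
      have d := side_dist hT h (hin (n+1)) e2
      have e : T.dist ((a ^ (n+1)) v) (a q) = T.dist ((a ^ n) v) q := by
        rw [pow_succ', g_mul, iso_dist_eq]
      have hs := hin (n+1)
      simp only [EdgeSide, Set.mem_ofPred_eq] at hs e2
      rw [T.dist_comm, T.dist_comm (u := p)] at hs
      omega
    have : ∀ n : ℕ, T.dist ((a ^ n) v) q + n ≤ T.dist v q := by
      intro n
      induction n with
      | zero => simp
      | succ n ih => have := dec n; omega
    have := this (T.dist v q + 1)
    omega
  obtain ⟨n, hn⟩ := ex
  rw [eventually_atTop]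
  refine ⟨n, fun m hm => ?_⟩
  induction m, hm using Nat.le_induction with
  | base => exact hn
  | succ m _ ih =>
    rw [pow_succ', g_mul]
    exact axis_nested hT h hax ih

theorem axis_inv {T : SimpleGraph V} {a : T ≃g T} {p q : V}
    (hax : T.dist p (a q) = T.dist q (a p) + 2) :
    T.dist q (a⁻¹ p) = T.dist p (a⁻¹ q) + 2 := by
  rw [← iso_dist_eq T a q, ← iso_dist_eq T a p, g_inv_apply, g_inv_apply, T.dist_comm, hax,
    T.dist_comm]

theorem axis_next {T : SimpleGraph V} (hT : T.IsTree) {a : T ≃g T}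
    (hev : ∀ x, Even (T.dist x (a x))) (hyp : IsHyperbolic T a) {x : V}
    (hx : T.dist x (a x) = transLen T a) :
    ∃ y, T.Adj x y ∧ T.dist x (a y) = T.dist y (a x) + 2 ∧ T.dist y (a y) = transLen T a ∧
      T.dist y (a x) + 1 = transLen T a := by
  have hmin : ∀ z, transLen T a ≤ T.dist z (a z) := fun z => Nat.sInf_le ⟨z, rfl⟩
  have hpos : 0 < transLen T a := hyp
  have heven := hev x
  rw [hx] at heven
  obtain ⟨m, hm⟩ := heven
  have hne : x ≠ a x := by
    intro e
    rw [← e, SimpleGraph.dist_self] at hx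
    omega
  obtain ⟨y, hxy, hd⟩ := tr_ex hT hne
  rw [T.dist_comm, hx, T.dist_comm] at hd
  have h' : T.Adj (a x) (a y) := a.map_adj_iff.2 hxy
  have c1 := tr_T1 hT x h'
  have c2 := tr_T1 hT y h'
  have my := hmin y
  have key : T.dist x (a y) = transLen T a + 1 := by
    rcases c1 with c1 | c1
    · exfalso
      have hne2 : x ≠ a y := by
        intro e
        rw [← e, SimpleGraph.dist_self] at c1
        omega
      obtain ⟨z, hxz, hz⟩ := tr_ex hT hne2
      rw [T.dist_comm] at hz
      have hz2 := tr_T1 hT z h'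
      have hz3 := tr_T1 hT (a x) hxz
      rw [T.dist_comm (u := a y)] at hz
      rw [T.dist_comm (u := a x), T.dist_comm (u := a x)] at hz3
      have : z = y := tr_T2 hT (u := a x) hxz hxy
        (by rw [T.dist_comm, T.dist_comm (v := z)]; omega)
        (by rw [T.dist_comm, T.dist_comm (v := y)]; omega)
      subst this
      omega
    · omega
  refine ⟨y, hxy, by omega, ?_, by omega⟩
  have c3 := tr_T1 hT (a y) hxy
  rw [T.dist_comm (u := a y), T.dist_comm (u := a y)] at c3
  omega

theorem even_of_mem {d : ℕ} {T : SimpleGraph V} (hT : T.IsTree)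
    {ι : LegalColoring T d} {F : Subgroup (Equiv.Perm (Fin d))} {a : T ≃g T}
    (ha : a ∈ UFplus T F ι) : ∀ x, Even (T.dist x (a x)) := by
  unfold UFplus at ha
  induction ha using Subgroup.closure_induction with
  | mem g hg =>
    obtain ⟨-, p, -, -, hp, -⟩ := hg
    intro x
    have h1 := tr_parity' hT p x (g x)
    have h2 := iso_dist_eq T g p x
    rw [hp] at h2
    rw [Nat.even_iff] at *
    omega
  | one => intro x; simp
  | mul g k _ _ hg hk =>
    intro x
    have h1 := tr_parity' hT (k x) x (g (k x))
    have h2 := hg (k x)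
    have h3 := hk x
    rw [T.dist_comm] at h3
    rw [g_mul]
    rw [Nat.even_iff] at *
    omega
  | inv g _ hg =>
    intro x
    have := hg (g⁻¹ x)
    rwa [g_inv_apply, T.dist_comm] at this

/-! topology -/

theorem tendsto_aut {T : SimpleGraph V} (G : Subgroup (T ≃g T)) (f : ℕ → G)
    (h : ∀ v, ∀ᶠ n in atTop, (f n : T ≃g T) v = v) : Tendsto f atTop (𝓝 1) := by
  rw [tendsto_subtype_rng]
  letI : TopologicalSpace V := ⊥
  haveI : DiscreteTopology V := ⟨rfl⟩
  have hind : Topology.IsInducing (fun (g : T ≃g T) (x : V) => g x) := ⟨rfl⟩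
  rw [hind.tendsto_nhds_iff, tendsto_pi_nhds]
  intro v
  refine tendsto_nhds_of_eventually_eq ?_
  filter_upwards [h v] with n hn
  exact hn

/-! final assembly -/

theorem edge_mem {d : ℕ} {T : SimpleGraph V} (hT : T.IsTree)
    (ι : LegalColoring T d) (F : Subgroup (Equiv.Perm (Fin d)))
    (a : UFplus T F ι) {p q : V} (h : T.Adj p q)
    (hax : T.dist p ((a : T ≃g T) q) = T.dist q ((a : T ≃g T) p) + 2)
    (g : T ≃g T) (hg : InUF T F ι g) (hp : g p = p) (hq : g q = q) :
    g ∈ (Subgroup.closure (Upos a ∪ Uneg a)).map (UFplus T F ι).subtype := by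
  obtain ⟨g₁, hu, h1, h2⟩ := tits hT h hg hp hq
  have g1p : g₁ p = p := h1 p (side_left h)
  have g1q : g₁ q = q := by rw [h2 q (side_left h.symm), hq]
  have inv_fix : ∀ v, g₁ v = v → g₁⁻¹ v = v := by
    intro v hv
    conv_lhs => rw [← hv, g_apply_inv]
  have hu2 : InUF T F ι (g₁⁻¹ * g) := inUF_mul (inUF_inv hu) hg
  have m1 : g₁ ∈ UFplus T F ι := Subgroup.subset_closure ⟨hu, p, q, h, g1p, g1q⟩
  have m2 : g₁⁻¹ * g ∈ UFplus T F ι := Subgroup.subset_closure ⟨hu2, p, q, h,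
    by rw [g_mul, hp, inv_fix p g1p], by rw [g_mul, hq, inv_fix q g1q]⟩
  have u1 : (⟨g₁, m1⟩ : UFplus T F ι) ∈ Uneg a := by
    refine tendsto_aut (UFplus T F ι)
      (fun n : ℕ => ((a ^ n)⁻¹)⁻¹ * (⟨g₁, m1⟩ : UFplus T F ι) * (a ^ n)⁻¹) ?_
    intro v
    filter_upwards [axis_enter hT h.symm (axis_inv hax) v] with n hn
    have := h1 _ hn
    simp only [Subgroup.coe_mul, Subgroup.coe_inv, Subgroup.coe_pow, inv_inv, g_mul]
    rw [inv_pow] at this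
    rw [this, g_inv_apply]
  have u2 : (⟨g₁⁻¹ * g, m2⟩ : UFplus T F ι) ∈ Upos a := by
    refine tendsto_aut (UFplus T F ι)
      (fun n : ℕ => (a ^ n)⁻¹ * (⟨g₁⁻¹ * g, m2⟩ : UFplus T F ι) * a ^ n) ?_
    intro v
    filter_upwards [axis_enter hT h hax v] with n hn
    have := h2 _ hn
    simp only [Subgroup.coe_mul, Subgroup.coe_inv, Subgroup.coe_pow, g_mul]
    rw [← this, g_apply_inv, g_apply_inv]
  have e : g = (UFplus T F ι).subtype ⟨g₁, m1⟩ * (UFplus T F ι).subtype ⟨g₁⁻¹ * g, m2⟩ :=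
    (mul_inv_cancel_left g₁ g).symm
  rw [e]
  exact Subgroup.mul_mem _
    (Subgroup.mem_map_of_mem _ (Subgroup.subset_closure (Or.inr u1)))
    (Subgroup.mem_map_of_mem _ (Subgroup.subset_closure (Or.inl u2)))

/-- Let `F` be primitive but not cyclic of prime order and
`𝔾 = U(F)⁺`.  Then for every hyperbolic `a ∈ 𝔾`, `𝔾 = ⟨U⁺_a, U⁻_a⟩`. -/
theorem generated_by_contraction_groups
    {V : Type} (T : SimpleGraph V) (d : ℕ) (hd : 3 ≤ d)
    (hT : T.IsTree) (hreg : Regular T d) (ι : LegalColoring T d)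
    (F : Subgroup (Equiv.Perm (Fin d)))
    (hprim : PermPrimitive F) (hncyc : ¬ CyclicOfPrimeOrder F) :
    ∀ a : UFplus T F ι, IsHyperbolic T (a : T ≃g T) →
      Subgroup.closure (Upos a ∪ Uneg a) = (⊤ : Subgroup (UFplus T F ι)) := by

  intro a ha
  have hev := even_of_mem hT a.2
  haveI : Nonempty V := hT.connected.nonempty
  obtain ⟨x0, hx0⟩ : ∃ x, T.dist x ((a : T ≃g T) x) = transLen T (a : T ≃g T) :=
    Nat.sInf_mem (Set.range_nonempty fun x : V => T.dist x ((a : T ≃g T) x))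
  obtain ⟨x1, a01, e01, hx1, f01⟩ := axis_next hT hev ha hx0
  obtain ⟨x2, a12, e12, hx2, f12⟩ := axis_next hT hev ha hx1
  obtain ⟨x3, a23, e23, hx3, f23⟩ := axis_next hT hev ha hx2
  have n02 : x0 ≠ x2 := by rintro rfl; omega
  have n13 : x1 ≠ x3 := by rintro rfl; omega
  let H := (Subgroup.closure (Upos a ∪ Uneg a)).map (UFplus T F ι).subtype
  have E1 := edge_mem hT ι F a a01 e01
  have E2 := edge_mem hT ι F a a12 e12
  have E3 := edge_mem hT ι F a a23 e23
  have P1 := vertex_gen hd hT ι hprim hncyc H a01.symm a12 n02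
    (fun g hg h h' => E1 g hg h' h) (fun g hg h h' => E2 g hg h h')
  have P2 := vertex_gen hd hT ι hprim hncyc H a12.symm a23 n13
    (fun g hg h h' => E2 g hg h' h) (fun g hg h h' => E3 g hg h h')
  have hall := all_gen hT ι hprim H a12 P1 P2
  have hle : UFplus T F ι ≤ H := by
    unfold UFplus
    rw [Subgroup.closure_le]
    rintro g ⟨hg, x, y, -, hx, -⟩
    exact hall x g hg hx
  rw [eq_top_iff]
  rintro ⟨g, hg⟩ -
  obtain ⟨k, hk, e⟩ := hle hg
  have : k = ⟨g, hg⟩ := Subtype.ext e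
  exact this ▸ hk

end TreeHM
end
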